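/- arXiv:2206.04690 — 2 statements merged into one kernel-verified Lean document; each statement's English description precedes it below -/
import Mathlib

section
/- Let p ≥ 1 and let ψ₁, ψ₂ > 0, v₁, v₂ ≥ 0 and φ₁, φ₂ ≥ 0 be real numbers. For a pair a = (a₁,a₂) write ∇a = a₁ − a₂ and av(a) = (a₁ + a₂)/2, applied componentwise to products and powers. Then ∇(φ²v^{2p−1}ψ)·∇(ψ^{−1}v) ≥ (1/(2p))·av(φ²)·(∇(v^p))² − (6 + 160p)·( |∇ψ · ∇(ψ^{−1})|·av(φ²) + (∇φ)² )·av(v^{2p}), i.e. (φ₁²v₁^{2p−1}ψ₁ − φ₂²v₂^{2p−1}ψ₂)(v₁/ψ₁ − v₂/ψ₂) ≥ (1/(2p))·((φ₁²+φ₂²)/2)·(v₁^p − v₂^p)² − (6+160p)·( |(ψ₁−ψ₂)(1/ψ₁−1/ψ₂)|·(φ₁²+φ₂²)/2 + (φ₁−φ₂)² )·(v₁^{2p}+v₂^{2p})/2. -/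
open Real

/-- Weighted AM-GM for the mixed product `a ^ (2p - 1) * b`. -/
lemma rpow_two_mul_sub_one_mul_le {p a b : ℝ} (hp : 1 ≤ p) (ha : 0 ≤ a) (hb : 0 ≤ b) :
    a ^ (2 * p - 1) * b ≤ (1 - 1 / p) * (a ^ p) ^ 2 + 1 / p * (a ^ p * b ^ p) := by
  have hp0 : 0 < p := by linarith
  have hinv : 1 / p ≤ 1 := (div_le_one hp0).2 hp
  have key := Real.geom_mean_le_arith_mean2_weighted (sub_nonneg.2 hinv)
    (one_div_pos.2 hp0).le (sq_nonneg (a ^ p))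
    (mul_nonneg (rpow_nonneg ha p) (rpow_nonneg hb p)) (sub_add_cancel 1 (1 / p))
  have h₁ : ((a ^ p) ^ 2) ^ (1 - 1 / p) = a ^ (2 * p - 2) := by
    rw [← rpow_natCast, ← rpow_mul ha, ← rpow_mul ha]
    congr 1
    push_cast
    field_simp
  have h₂ : (a ^ p * b ^ p) ^ (1 / p) = a * b := by
    rw [← mul_rpow ha hb, one_div, rpow_rpow_inv (mul_nonneg ha hb) hp0.ne']
  have h₃ : a ^ (2 * p - 1) = a ^ (2 * p - 2) * a := by
    rw [← rpow_add_one' ha (by linarith)]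
    congr 1
    ring
  rw [h₁, h₂, ← mul_assoc, ← h₃] at key
  exact key

/-- The mixed products satisfy `|a ^ (2p - 1) b - b ^ (2p - 1) a| ≤ |a ^ (2p) - b ^ (2p)|`. -/
lemma abs_rpow_mul_sub_rpow_mul_le {w a b : ℝ} (hw : 0 ≤ w) (ha : 0 ≤ a) (hb : 0 ≤ b) :
    |a ^ w * b - b ^ w * a| ≤ |a ^ w * a - b ^ w * b| := by
  have haw := rpow_nonneg ha w
  have hbw := rpow_nonneg hb w
  have hmono : 0 ≤ (a ^ w - b ^ w) * (a - b) := by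
    rcases le_total a b with h | h
    · exact mul_nonneg_of_nonpos_of_nonpos
        (sub_nonpos.2 (rpow_le_rpow ha h hw)) (sub_nonpos.2 h)
    · exact mul_nonneg (sub_nonneg.2 (rpow_le_rpow hb h hw)) (sub_nonneg.2 h)
  refine sq_le_sq.1 ?_
  linarith [mul_nonneg (mul_nonneg (add_nonneg haw hbw) (add_nonneg ha hb)) hmono]

set_option maxHeartbeats 1000000 in
/-- The algebraic core: `x`, `y` stand for `v₁ ^ p`, `v₂ ^ p`, the numbers `P`, `Q` for the mixed
products, and `t` for the ratio `ψ₁ / ψ₂`. -/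
lemma cutoff_form_lower_bound {p x y P Q t φ₁ φ₂ : ℝ} (hp : 1 ≤ p) (hx : 0 ≤ x) (hy : 0 ≤ y)
    (hP : 0 ≤ P) (hQ : 0 ≤ Q) (ht : 0 < t) (hφ₁ : 0 ≤ φ₁) (hφ₂ : 0 ≤ φ₂)
    (hsum : 1 / p * (x - y) ^ 2 ≤ x ^ 2 + y ^ 2 - P - Q)
    (hdiff : |P - Q| ≤ |x ^ 2 - y ^ 2|) :
    1 / (2 * p) * ((φ₁ ^ 2 + φ₂ ^ 2) / 2) * (x - y) ^ 2
      - (6 + 160 * p) * ((t + 1 / t - 2) * ((φ₁ ^ 2 + φ₂ ^ 2) / 2) + (φ₁ - φ₂) ^ 2) *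
          ((x ^ 2 + y ^ 2) / 2)
    ≤ φ₁ ^ 2 * (x ^ 2 - P * t) + φ₂ ^ 2 * (y ^ 2 - Q * (1 / t)) := by
  have hp0 : 0 < p := by linarith
  obtain ⟨K, hK⟩ : ∃ K, K = t + 1 / t - 2 := ⟨_, rfl⟩
  obtain ⟨h, hh⟩ : ∃ h, h = (t - 1 / t) / 2 := ⟨_, rfl⟩
  have hK0 : 0 ≤ K := by
    have : K = (t - 1) ^ 2 / t := by rw [hK]; field_simp; ring
    rw [this]; positivity
  have hhK : h ^ 2 = K ^ 2 / 4 + K := by rw [hK, hh]; field_simp; ring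
  have ht1 : t = 1 + K / 2 + h := by rw [hK, hh]; ring
  have ht2 : 1 / t = 1 + K / 2 - h := by rw [hK, hh]; ring
  rw [← hK, ht2]
  rw [ht1]
  clear hK hh ht1 ht2
  obtain ⟨k, hk0, rfl⟩ : ∃ k, 0 ≤ k ∧ K = k ^ 2 := ⟨√K, sqrt_nonneg K, (sq_sqrt hK0).symm⟩
  have hh : |h| ≤ k ^ 2 / 2 + k := by
    refine abs_le_of_sq_le_sq ?_ (by positivity)
    nlinarith [pow_nonneg hk0 3]
  obtain ⟨T, hT⟩ : ∃ T, T = x ^ 2 + y ^ 2 := ⟨_, rfl⟩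
  obtain ⟨D, hD⟩ : ∃ D, D = |x - y| := ⟨_, rfl⟩
  obtain ⟨S, hS⟩ : ∃ S, S = x + y := ⟨_, rfl⟩
  obtain ⟨d, hd⟩ : ∃ d, d = |φ₁ - φ₂| := ⟨_, rfl⟩
  obtain ⟨m, hm⟩ : ∃ m, m = (φ₁ + φ₂) / 2 := ⟨_, rfl⟩
  obtain ⟨M, hM⟩ : ∃ M, M = (φ₁ ^ 2 + φ₂ ^ 2) / 2 := ⟨_, rfl⟩
  obtain ⟨N, hN⟩ : ∃ N, N = (φ₁ ^ 2 - φ₂ ^ 2) / 2 := ⟨_, rfl⟩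
  have hD0 : 0 ≤ D := hD ▸ abs_nonneg _
  have hd0 : 0 ≤ d := hd ▸ abs_nonneg _
  have hS0 : 0 ≤ S := by rw [hS]; positivity
  have hm0 : 0 ≤ m := by rw [hm]; positivity
  have hM0 : 0 ≤ M := by rw [hM]; positivity
  have hT0 : 0 ≤ T := by rw [hT]; positivity
  have hDsq : (x - y) ^ 2 = D ^ 2 := by rw [hD, sq_abs]
  have hdsq : (φ₁ - φ₂) ^ 2 = d ^ 2 := by rw [hd, sq_abs]
  have hST : S ^ 2 ≤ 2 * T := by rw [hS, hT]; nlinarith [sq_nonneg (x - y)]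
  have hmM : m ^ 2 ≤ M := by rw [hm, hM]; nlinarith [sq_nonneg (φ₁ - φ₂)]
  have hNd : |N| = d * m := by
    rw [hN, hd, hm, show (φ₁ ^ 2 - φ₂ ^ 2) / 2 = (φ₁ - φ₂) * ((φ₁ + φ₂) / 2) by ring, abs_mul,
      abs_of_nonneg (a := (φ₁ + φ₂) / 2) (by positivity)]
  have hNM : |N| ≤ M := by
    rw [hN, hM, abs_le]
    constructor <;> linarith [sq_nonneg φ₁, sq_nonneg φ₂]
  have hEF : |x ^ 2 - y ^ 2| = D * S := by
    rw [hD, hS, show x ^ 2 - y ^ 2 = (x - y) * (x + y) by ring, abs_mul,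
      abs_of_nonneg (a := x + y) (by positivity)]
  have hPQ : P + Q ≤ T := by
    have : 0 ≤ 1 / p * (x - y) ^ 2 := by positivity
    rw [hT]; linarith
  have hPQ' : |P - Q| ≤ T := abs_le.2 ⟨by linarith, by linarith⟩
  have hu : p * (1 / p) = 1 := by field_simp
  have hu0 : 0 < 1 / p := by positivity
  have hu2 : 1 / (2 * p) = 1 / p / 2 := by field_simp
  obtain ⟨u, hup⟩ : ∃ u, u = 1 / p := ⟨_, rfl⟩
  rw [hu2]
  rw [← hup] at hu hu0 hsum ⊢
  rw [hDsq, ← hT] at hsum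
  -- Young's inequality with the weight `p`.
  have young (r s : ℝ) : r * s ≤ u / 4 * r ^ 2 + p * s ^ 2 := by
    have h₁ : 0 ≤ u * (r / 2 - p * s) ^ 2 := by positivity
    have h₂ : u * (r / 2 - p * s) ^ 2
        = u / 4 * r ^ 2 - (p * u) * (r * s) + (p * u) * (p * s ^ 2) := by ring
    rw [h₂, hu] at h₁
    linarith
  have b₁ : |(P - Q) * h| ≤ u / 4 * D ^ 2 + (1 / 2 + 2 * p) * (k ^ 2 * T) := by
    calc |(P - Q) * h| = |P - Q| * |h| := abs_mul _ _
      _ ≤ |P - Q| * (k ^ 2 / 2 + k) := by gcongr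
      _ = |P - Q| * (k ^ 2 / 2) + |P - Q| * k := by ring
      _ ≤ T * (k ^ 2 / 2) + D * S * k := by gcongr; exact hdiff.trans hEF.le
      _ = T * (k ^ 2 / 2) + D * (S * k) := by ring
      _ ≤ T * (k ^ 2 / 2) + (u / 4 * D ^ 2 + p * (S * k) ^ 2) := by gcongr; exact young _ _
      _ = T * (k ^ 2 / 2) + (u / 4 * D ^ 2 + p * (S ^ 2 * k ^ 2)) := by ring
      _ ≤ T * (k ^ 2 / 2) + (u / 4 * D ^ 2 + p * (2 * T * k ^ 2)) := by gcongr
      _ = _ := by ring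
  have b₂ : |N * (x ^ 2 - y ^ 2 - (P - Q))| ≤ u / 4 * (M * D ^ 2) + 8 * p * (d ^ 2 * T) := by
    have hsub : |x ^ 2 - y ^ 2 - (P - Q)| ≤ 2 * (D * S) := by
      linarith [abs_sub (x ^ 2 - y ^ 2) (P - Q)]
    calc |N * (x ^ 2 - y ^ 2 - (P - Q))| = d * m * |x ^ 2 - y ^ 2 - (P - Q)| := by
          rw [abs_mul, hNd]
      _ ≤ d * m * (2 * (D * S)) := by gcongr
      _ = (m * D) * (2 * (d * S)) := by ring
      _ ≤ u / 4 * (m * D) ^ 2 + p * (2 * (d * S)) ^ 2 := young _ _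
      _ = u / 4 * (m ^ 2 * D ^ 2) + 4 * p * (d ^ 2 * S ^ 2) := by ring
      _ ≤ u / 4 * (M * D ^ 2) + 4 * p * (d ^ 2 * (2 * T)) := by gcongr
      _ = _ := by ring
  have b₃ : |N * (P - Q) * (k ^ 2 / 2)| ≤ 1 / 2 * (M * (k ^ 2 * T)) := by
    calc |N * (P - Q) * (k ^ 2 / 2)| = |N| * |P - Q| * (k ^ 2 / 2) := by
          rw [abs_mul, abs_mul, abs_of_nonneg (a := k ^ 2 / 2) (by positivity)]
      _ ≤ M * T * (k ^ 2 / 2) := by gcongr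
      _ = _ := by ring
  have b₄ : |N * (P + Q) * h| ≤ M * (k ^ 2 * T) + 1 / 2 * (d ^ 2 * T) := by
    calc |N * (P + Q) * h| = |N| * (P + Q) * |h| := by
          rw [abs_mul, abs_mul, abs_of_nonneg (add_nonneg hP hQ)]
      _ ≤ |N| * T * (k ^ 2 / 2 + k) := by gcongr
      _ = |N| * (T * (k ^ 2 / 2)) + d * (m * k) * T := by rw [hNd]; ring
      _ ≤ M * (T * (k ^ 2 / 2)) + (d ^ 2 + m ^ 2 * k ^ 2) / 2 * T := by
          gcongr
          linarith [two_mul_le_add_sq d (m * k), mul_pow m k 2]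
      _ ≤ M * (T * (k ^ 2 / 2)) + (d ^ 2 + M * k ^ 2) / 2 * T := by gcongr
      _ = _ := by ring
  have b₅ := mul_le_mul_of_nonneg_left hsum hM0
  have b₆ := mul_le_mul_of_nonneg_left (le_of_abs_le b₁) hM0
  have b₇ : M * ((P + Q) * (k ^ 2 / 2)) ≤ M * (T * (k ^ 2 / 2)) := by gcongr
  have expand : φ₁ ^ 2 * (x ^ 2 - P * (1 + k ^ 2 / 2 + h))
        + φ₂ ^ 2 * (y ^ 2 - Q * (1 + k ^ 2 / 2 - h))
      = M * (T - P - Q) - M * ((P + Q) * (k ^ 2 / 2)) - M * ((P - Q) * h)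
        + N * (x ^ 2 - y ^ 2 - (P - Q)) - N * (P - Q) * (k ^ 2 / 2) - N * (P + Q) * h := by
    rw [hM, hN, hT]; ring
  have c₁ : 0 ≤ M * (k ^ 2 * T) := by positivity
  have c₂ : 0 ≤ d ^ 2 * T := by positivity
  have c₃ : 0 ≤ p * (M * (k ^ 2 * T)) := by positivity
  have c₄ : 0 ≤ p * (d ^ 2 * T) := by positivity
  rw [expand, ← hM, ← hT, hDsq, hdsq]
  linarith [neg_le_of_abs_le b₂, le_of_abs_le b₃, le_of_abs_le b₄]

/-- The pointwise inequality behind the energy estimate for subsolutions: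
for `p ≥ 1`, `ψ₁, ψ₂ > 0`, `v₁, v₂ ≥ 0`, `φ₁, φ₂ ≥ 0`,
`∇(φ²v^{2p−1}ψ)·∇(ψ⁻¹v) ≥ (1/(2p))·av(φ²)·(∇v^p)² − (6+160p)(|∇ψ∇ψ⁻¹|·av(φ²)+(∇φ)²)·av(v^{2p})`. -/
theorem pointwise_claim (p : ℝ) (hp : 1 ≤ p)
    (ψ₁ ψ₂ : ℝ) (hψ₁ : 0 < ψ₁) (hψ₂ : 0 < ψ₂)
    (v₁ v₂ : ℝ) (hv₁ : 0 ≤ v₁) (hv₂ : 0 ≤ v₂)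
    (φ₁ φ₂ : ℝ) (hφ₁ : 0 ≤ φ₁) (hφ₂ : 0 ≤ φ₂) :
    (1 / (2 * p)) * ((φ₁ ^ 2 + φ₂ ^ 2) / 2) * (v₁ ^ p - v₂ ^ p) ^ 2
      - (6 + 160 * p) *
          (|(ψ₁ - ψ₂) * (1 / ψ₁ - 1 / ψ₂)| * ((φ₁ ^ 2 + φ₂ ^ 2) / 2) + (φ₁ - φ₂) ^ 2) *
          ((v₁ ^ (2 * p) + v₂ ^ (2 * p)) / 2)
    ≤ (φ₁ ^ 2 * v₁ ^ (2 * p - 1) * ψ₁ - φ₂ ^ 2 * v₂ ^ (2 * p - 1) * ψ₂) *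
        (v₁ / ψ₁ - v₂ / ψ₂) := by
  have hp0 : 0 < p := by linarith
  have hsplit {v : ℝ} (hv : 0 ≤ v) : v ^ (2 * p - 1) * v = (v ^ p) ^ 2 := by
    rw [← rpow_add_one' hv (by linarith), ← rpow_natCast, ← rpow_mul hv]
    congr 1
    push_cast
    ring
  have hsq {v : ℝ} (hv : 0 ≤ v) : v ^ (2 * p) = (v ^ p) ^ 2 := by
    rw [← rpow_natCast, ← rpow_mul hv, mul_comm]
    norm_cast
  have hdiff := abs_rpow_mul_sub_rpow_mul_le (w := 2 * p - 1) (by linarith) hv₁ hv₂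
  rw [hsplit hv₁, hsplit hv₂] at hdiff
  have hsum : 1 / p * (v₁ ^ p - v₂ ^ p) ^ 2
      ≤ (v₁ ^ p) ^ 2 + (v₂ ^ p) ^ 2 - v₁ ^ (2 * p - 1) * v₂ - v₂ ^ (2 * p - 1) * v₁ := by
    linarith [rpow_two_mul_sub_one_mul_le hp hv₁ hv₂, rpow_two_mul_sub_one_mul_le hp hv₂ hv₁]
  have key := cutoff_form_lower_bound hp (rpow_nonneg hv₁ p) (rpow_nonneg hv₂ p)
    (mul_nonneg (rpow_nonneg hv₁ _) hv₂) (mul_nonneg (rpow_nonneg hv₂ _) hv₁)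
    (div_pos hψ₁ hψ₂) hφ₁ hφ₂ hsum hdiff
  have hK : |(ψ₁ - ψ₂) * (1 / ψ₁ - 1 / ψ₂)| = ψ₁ / ψ₂ + 1 / (ψ₁ / ψ₂) - 2 := by
    have h₁ : (ψ₁ - ψ₂) * (1 / ψ₁ - 1 / ψ₂) = -((ψ₁ - ψ₂) ^ 2 / (ψ₁ * ψ₂)) := by
      field_simp
      ring
    rw [h₁, abs_neg, abs_of_nonneg (by positivity)]
    field_simp
    ring
  rw [hK, hsq hv₁, hsq hv₂]
  refine key.trans_eq ?_
  rw [← hsplit hv₁, ← hsplit hv₂]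
  field_simp
  ring
end

section
/- Let B ⊆ X be finite, μ : B → (0,∞), p ∈ [1,∞] with Hölder conjugate q, ω : X → ℝ bounded, T₁ ≤ T₂ ≤ T₃ < T₄, s ≥ 1, and let v ≥ 0 be a bounded supersolution of the Δ_ω-heat equation on [T₁,T₄] × B. Then max_{t∈[T₂,T₃]} ‖v_t^s‖₁ ≤ ( μ(B)^{1/p}/(T₄ − T₃) + s‖Deg‖_p ) ∫_{T₁}^{T₄} ‖v_τ^s‖_q dτ, where all norms are ℓ^p(B,μ)-norms and Deg(x) = (1/m(x))Σ_y b(x,y). -/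
open Real MeasureTheory
open scoped ENNReal NNReal

noncomputable section

namespace GraphHeat

variable {X : Type*}

/-- weighted volume of a set of vertices -/
def vol (m : X → ℝ) (A : Set X) : ℝ := ∑' y : A, m y

/-- squared `ℓ²(X,m)` norm -/
def sq2 (m : X → ℝ) (f : X → ℝ) : ℝ := ∑' x, m x * f x ^ 2

/-- `ℓ²(X,m)` norm -/
def l2n (m : X → ℝ) (f : X → ℝ) : ℝ := Real.sqrt (sq2 m f)

/-- `ℓ^p(X,m)` norm for a real exponent `p` -/
def lpn (m : X → ℝ) (p : ℝ) (f : X → ℝ) : ℝ := (∑' x, m x * |f x| ^ p) ^ (1 / p)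

/-- membership in `ℓ²(X,m)` -/
def Meml2 (m : X → ℝ) (f : X → ℝ) : Prop := Summable (fun x => m x * f x ^ 2)

/-- the graph Laplacian in divergence form -/
def lap (b : X → X → ℝ) (m : X → ℝ) (f : X → ℝ) (x : X) : ℝ :=
  (1 / m x) * ∑' y, b x y * (f x - f y)

/-- the sandwiched Laplacian `Δ_ω v = e^ω Δ (e^{-ω} v)` -/
def lapOm (b : X → X → ℝ) (m : X → ℝ) (ω : X → ℝ) (f : X → ℝ) (x : X) : ℝ :=
  Real.exp (ω x) * lap b m (fun y => Real.exp (-ω y) * f y) x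

/-- the modulus of the gradient `|∇ f|(x)` -/
def gradN (b : X → X → ℝ) (m : X → ℝ) (f : X → ℝ) (x : X) : ℝ :=
  Real.sqrt ((1 / m x) * ∑' y, b x y * (f x - f y) ^ 2)

/-- `h(ω) = sup_x Σ_y (b(x,y)/m(x)) |∇_{xy} e^ω ∇_{xy} e^{-ω}|` -/
def hOm (b : X → X → ℝ) (m : X → ℝ) (ω : X → ℝ) : ℝ :=
  ⨆ x, ∑' y, (b x y / m x) *
    |(Real.exp (ω x) - Real.exp (ω y)) * (Real.exp (-ω x) - Real.exp (-ω y))|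

/-- boundedness of a function on the vertex set -/
def Bd (ω : X → ℝ) : Prop := ∃ M, ∀ x, |ω x| ≤ M

/-- the distance ball `B_x(R)` -/
def ball (ρ : X → X → ℝ) (x : X) (R : ℝ) : Set X := {y | ρ x y ≤ R}

/-- the combinatorial interior `A°` of a set `A` -/
def intr (b : X → X → ℝ) (A : Set X) : Set X := {x ∈ A | ∀ y, y ∉ A → b x y = 0}

/-- the weighted vertex degree `Deg(x) = deg(x)/m(x)` -/
def Deg (b : X → X → ℝ) (m : X → ℝ) (x : X) : ℝ := (1 / m x) * ∑' y, b x y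

/-- the graph Gaussian `ζ_S(r,t)` -/
def zeta (S r t : ℝ) : ℝ :=
  (1 / S ^ 2) * (r * S * Real.arsinh (r * S / t) + t - Real.sqrt (t ^ 2 + r ^ 2 * S ^ 2))

/-- `σ(r,t) = 2 S⁻²(√(1 + r²S²/t²) − 1)` -/
def sigm (S r t : ℝ) : ℝ := (2 / S ^ 2) * (Real.sqrt (1 + r ^ 2 * S ^ 2 / t ^ 2) - 1)

/-- `ℓ^p`-norm over a finite set `B` with weight `μ`, `p ∈ [1,∞]` -/
def lpF {X : Type*} (B : Finset X) (μ : X → ℝ) (p : ℝ≥0∞) (f : X → ℝ) : ℝ :=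
  if p = ∞ then ⨆ x ∈ (B : Set X), |f x|
  else (∑ x ∈ B, μ x * |f x| ^ p.toReal) ^ (1 / p.toReal)

/-- `ℓ^p`-norm over a countable weighted space, with values in `ℝ≥0∞` -/
def lpE {B : Type*} (μ : B → ℝ) (p : ℝ≥0∞) (f : B → ℝ) : ℝ≥0∞ :=
  if p = ∞ then ⨆ x, (‖f x‖₊ : ℝ≥0∞)
  else (∑' x, ENNReal.ofReal (μ x) * (‖f x‖₊ : ℝ≥0∞) ^ p.toReal) ^ (1 / p.toReal)

/-- the `p`-mean `D_p(x,R)` of the weighted degree over the ball `B_x(R)` -/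
def Dp (b : X → X → ℝ) (m : X → ℝ) (ρ : X → X → ℝ) (p : ℝ≥0∞) (x : X) (R : ℝ) : ℝ :=
  if p = ∞ then ⨆ y ∈ ball ρ x R, Deg b m y
  else ((1 / vol m (ball ρ x R)) * ∑' y : ball ρ x R, m y * Deg b m y ^ p.toReal) ^ (1 / p.toReal)

/-- the `p`-mean `M_p(x,R)` of `1/m` over the ball `B_x(R)` -/
def Mp (m : X → ℝ) (ρ : X → X → ℝ) (p : ℝ≥0∞) (x : X) (R : ℝ) : ℝ :=
  if p = ∞ then ⨆ y ∈ ball ρ x R, 1 / m y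
  else ((1 / vol m (ball ρ x R)) * ∑' y : ball ρ x R, m y * (1 / m y) ^ p.toReal) ^ (1 / p.toReal)

/-- `κ(r) = ⌊√(r/4S) − 2⌋` -/
def kappa (S r : ℝ) : ℤ := ⌊Real.sqrt (r / (4 * S)) - 2⌋

/-- `θ(r) = (1/2)β^{−κ(r)}` -/
def theta (S β r : ℝ) : ℝ := (1 / 2) * β ^ (-(kappa S r))

/-- the error function `Γ_x(r)` -/
def Gam (b : X → X → ℝ) (m : X → ℝ) (ρ : X → X → ℝ) (S : ℝ) (p : ℝ≥0∞) (q β : ℝ)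
    (x : X) (r : ℝ) : ℝ :=
  ((1 + r ^ 2 * Dp b m ρ p x r) * Mp m ρ p x r ^ q * vol m (ball ρ x r) ^ q) ^ (theta S β r)

/-- the Sobolev inequality `S(n, R, R)` at `x` with constant `CS` -/
def Sob (b : X → X → ℝ) (m : X → ℝ) (ρ : X → X → ℝ) (x : X) (n CS R : ℝ) : Prop :=
  ∀ u : X → ℝ, Function.support u ⊆ intr b (ball ρ x R) →
    vol m (ball ρ x R) ^ (2 / n) / (CS * R ^ 2) * lpn m (2 * n / (n - 2)) u ^ 2 ≤
      sq2 m (gradN b m u) + (1 / R ^ 2) * sq2 m u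

/-- the volume doubling property `V(d, R₁, R₂)` at `x` with constant `CD` -/
def VD (m : X → ℝ) (ρ : X → X → ℝ) (x : X) (d CD R1 R2 : ℝ) : Prop :=
  ∀ r1 r2, R1 ≤ r1 → r1 ≤ r2 → r2 ≤ R2 →
    vol m (ball ρ x r2) ≤ CD * (r2 / r1) ^ d * vol m (ball ρ x r1)

/-- the sandwiched semigroup `P^ω_t = e^ω P_t e^{-ω}` -/
def POm (P : ℝ → (X → ℝ) → X → ℝ) (ω : X → ℝ) (t : ℝ) (f : X → ℝ) : X → ℝ :=
  fun x => Real.exp (ω x) * P t (fun y => Real.exp (-ω y) * f y) x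

/-- the `ℓ² → ℓ²` operator norm -/
def opn (m : X → ℝ) (A : (X → ℝ) → X → ℝ) : ℝ :=
  sSup {r | ∃ f, Meml2 m f ∧ l2n m f ≤ 1 ∧ r = l2n m (A f)}

/-- the constant `C_β` -/
def Cbeta (β : ℝ) : ℝ := 4 ^ (((4 + 1 / Real.log β) + β / (β - 1)) / (β - 1))

/-- the constant `C_{d,n}` -/
def Cdn (CS CD d n : ℝ) : ℝ :=
  max 1 CD * max 1 (CD ^ (n / 2 + 1) * CS ^ (n / 2)) *
    (10 : ℝ) ^ (8 * ((n + 2) * (d + 1) + n ^ 2 + n) + 1)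

section FiniteNorm

variable {B : Finset X} {μ : X → ℝ} {p q : ℝ≥0∞} {f g : X → ℝ}

lemma lpF_top (B : Finset X) (μ : X → ℝ) (f : X → ℝ) :
    lpF B μ ∞ f = (B.sup fun x => ‖f x‖₊ : ℝ≥0) := by
  have key : ∀ x, (⨆ _ : x ∈ (B : Set X), |f x|) ≤ (B.sup fun x => ‖f x‖₊ : ℝ≥0) := fun x =>
    Real.iSup_le (fun hx => by
      have := NNReal.coe_le_coe.2 (Finset.le_sup (f := fun x => ‖f x‖₊) (Finset.mem_coe.1 hx))
      simpa using this) (NNReal.coe_nonneg _)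
  rw [lpF, if_pos rfl]
  refine le_antisymm (Real.iSup_le key (NNReal.coe_nonneg _)) ?_
  have hnn : 0 ≤ ⨆ x, ⨆ _ : x ∈ (B : Set X), |f x| :=
    Real.iSup_nonneg fun x => Real.iSup_nonneg fun _ => abs_nonneg _
  rw [← Real.le_toNNReal_iff_coe_le hnn]
  refine Finset.sup_le fun x hx => ?_
  rw [Real.le_toNNReal_iff_coe_le hnn]
  refine le_ciSup_of_le ⟨_, Set.forall_mem_range.2 key⟩ x ?_
  rw [ciSup_pos (Finset.mem_coe.2 hx), coe_nnnorm, Real.norm_eq_abs]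

lemma lpF_of_ne_top (hp : p ≠ ∞) :
    lpF B μ p f = (∑ x ∈ B, μ x * |f x| ^ p.toReal) ^ (1 / p.toReal) :=
  if_neg hp

lemma lpF_one (B : Finset X) (μ : X → ℝ) (f : X → ℝ) :
    lpF B μ 1 f = ∑ x ∈ B, μ x * |f x| := by
  simp [lpF_of_ne_top]

lemma lpF_nonneg (hμ : ∀ x ∈ B, 0 < μ x) : 0 ≤ lpF B μ p f := by
  by_cases hp : p = ∞
  · rw [hp, lpF_top]
    exact NNReal.coe_nonneg _
  · rw [lpF_of_ne_top hp]
    exact rpow_nonneg (Finset.sum_nonneg fun x hx =>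
      mul_nonneg (hμ x hx).le (rpow_nonneg (abs_nonneg _) _)) _

lemma abs_le_lpF_top {x : X} (hx : x ∈ B) : |f x| ≤ lpF B μ ∞ f := by
  rw [lpF_top, ← Real.norm_eq_abs, ← coe_nnnorm, NNReal.coe_le_coe]
  exact Finset.le_sup (f := fun x => ‖f x‖₊) hx

lemma lpF_const_one_le (B : Finset X) (μ : X → ℝ) (p : ℝ≥0∞) :
    lpF B μ p (fun _ => 1) ≤ (∑ x ∈ B, μ x) ^ (1 / p.toReal) := by
  by_cases hp : p = ∞
  · rw [hp, lpF_top]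
    simp
  · simp [lpF_of_ne_top hp]

lemma lpF_one_mul_lpF_top (hμ : ∀ x ∈ B, 0 < μ x) :
    ∑ x ∈ B, μ x * (|f x| * |g x|) ≤ lpF B μ 1 f * lpF B μ ∞ g := by
  rw [lpF_one, Finset.sum_mul]
  refine Finset.sum_le_sum fun x hx => ?_
  rw [← mul_assoc]
  exact mul_le_mul_of_nonneg_left (abs_le_lpF_top hx) (mul_nonneg (hμ x hx).le (abs_nonneg _))

/-- Hölder's inequality over a finite weighted set. -/
lemma sum_mul_le_lpF_mul_lpF (hμ : ∀ x ∈ B, 0 < μ x) (hpq : p.HolderConjugate q) :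
    ∑ x ∈ B, μ x * (|f x| * |g x|) ≤ lpF B μ p f * lpF B μ q g := by
  by_cases hp : p = ∞
  · obtain rfl : q = 1 := by
      have := hpq.inv_add_inv_eq_inv
      simpa [hp] using this
    rw [hp, mul_comm]
    simpa only [mul_comm |f _|] using lpF_one_mul_lpF_top hμ
  by_cases hq : q = ∞
  · obtain rfl : p = 1 := by
      have := hpq.inv_add_inv_eq_inv
      simpa [hq] using this
    rw [hq]
    exact lpF_one_mul_lpF_top hμ
  have hr : p.toReal.HolderConjugate q.toReal := ENNReal.HolderConjugate.toReal_of_ne_top hp hq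
  have weight : ∀ {r : ℝ}, r ≠ 0 → ∀ h : X → ℝ, ∀ x ∈ B,
      |(μ x ^ (1 / r) * |h x| : ℝ)| ^ r = μ x * |h x| ^ r := fun {r} hr0 h x hx => by
    have h0 := (hμ x hx).le
    rw [abs_of_nonneg (by positivity), mul_rpow (by positivity) (abs_nonneg _), ← rpow_mul h0,
      one_div_mul_cancel hr0, rpow_one]
  have key := Real.inner_le_Lp_mul_Lq B (fun x => μ x ^ (1 / p.toReal) * |f x|)
    (fun x => μ x ^ (1 / q.toReal) * |g x|) hr
  rw [Finset.sum_congr rfl (weight hr.ne_zero f), Finset.sum_congr rfl (weight hr.symm.ne_zero g)]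
    at key
  rw [lpF_of_ne_top hp, lpF_of_ne_top hq]
  refine le_of_eq_of_le (Finset.sum_congr rfl fun x hx => ?_) key
  have : μ x = μ x ^ (1 / p.toReal) * μ x ^ (1 / q.toReal) := by
    rw [← rpow_add (hμ x hx), one_div, one_div, hr.inv_add_inv_eq_one, rpow_one]
  nth_rewrite 1 [this]
  ring

lemma continuousOn_lpF (hp : 1 ≤ p) {I : Set ℝ} {u : ℝ → X → ℝ}
    (hu : ∀ x ∈ B, ContinuousOn (fun t => u t x) I) :
    ContinuousOn (fun t => lpF B μ p (u t)) I := by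
  by_cases htop : p = ∞
  · subst htop
    simp only [lpF_top]
    exact NNReal.continuous_coe.comp_continuousOn
      (ContinuousOn.finset_sup_apply fun x hx => (hu x hx).nnnorm)
  · simp only [lpF_of_ne_top htop]
    refine ContinuousOn.rpow_const ?_ fun _ _ => Or.inr (by positivity)
    exact continuousOn_finsetSum _ fun x hx => continuousOn_const.mul
      ((hu x hx).abs.rpow_const fun _ _ => Or.inr ENNReal.toReal_nonneg)

end FiniteNorm

lemma Deg_nonneg {m : X → ℝ} (hm : ∀ x, 0 < m x) {b : X → X → ℝ} (hb : ∀ x y, 0 ≤ b x y) (x : X) :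
    0 ≤ Deg b m x :=
  mul_nonneg (one_div_nonneg.2 (hm x).le) (tsum_nonneg (hb x))

lemma lapOm_le_Deg_mul {m : X → ℝ} (hm : ∀ x, 0 < m x) {b : X → X → ℝ} (hb : ∀ x y, 0 ≤ b x y)
    (hlf : ∀ x, {y | b x y ≠ 0}.Finite) (ω : X → ℝ) {f : X → ℝ} (hf : ∀ x, 0 ≤ f x) (x : X) :
    lapOm b m ω f x ≤ Deg b m x * f x := by
  have hsum : ∀ c : X → ℝ, Summable fun y => b x y * c y := fun c =>
    summable_of_hasFiniteSupport <| (hlf x).subset fun y hy h => hy (by simp [h])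
  have hle : ∑' y, b x y * (exp (-ω x) * f x - exp (-ω y) * f y)
      ≤ (∑' y, b x y) * (exp (-ω x) * f x) := by
    rw [← tsum_mul_right]
    refine (hsum _).tsum_le_tsum (fun y => ?_) (hsum _)
    exact mul_le_mul_of_nonneg_left
      (sub_le_self _ (mul_nonneg (exp_pos _).le (hf y))) (hb x y)
  calc lapOm b m ω f x
      ≤ exp (ω x) * ((1 / m x) * ((∑' y, b x y) * (exp (-ω x) * f x))) := by
        unfold lapOm lap
        have := hm x
        gcongr
    _ = exp (ω x) * exp (-ω x) * (Deg b m x * f x) := by unfold Deg; ring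
    _ = Deg b m x * f x := by rw [← exp_add, add_neg_cancel, exp_zero, one_mul]

/-- If `F` decreases at rate at most `c N` and `F ≤ a N`, then `F` is controlled by the integral
of `N`. -/
lemma le_integral_of_neg_le_deriv {F F' N : ℝ → ℝ} {a c T₁ T₃ T₄ t : ℝ} (ht₁ : T₁ ≤ t)
    (ht₃ : t ≤ T₃) (hT : T₃ < T₄) (ha : 0 ≤ a) (hc : 0 ≤ c)
    (hF : ∀ τ ∈ Set.Icc T₁ T₄, HasDerivWithinAt F (F' τ) (Set.Icc T₁ T₄) τ)
    (hN : ContinuousOn N (Set.Icc T₁ T₄)) (hN0 : ∀ τ ∈ Set.Icc T₁ T₄, 0 ≤ N τ)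
    (hF' : ∀ τ ∈ Set.Icc T₁ T₄, -(c * N τ) ≤ F' τ)
    (hFN : ∀ τ ∈ Set.Icc T₁ T₄, F τ ≤ a * N τ) :
    F t ≤ (a / (T₄ - T₃) + c) * ∫ τ in T₁..T₄, N τ := by
  have htT : t < T₄ := ht₃.trans_lt hT
  set K := ∫ τ in T₁..T₄, N τ
  have hNint : IntervalIntegrable N volume T₁ T₄ := hN.intervalIntegrable_of_Icc (ht₁.trans htT.le)
  have hsub : ∀ {τ σ}, T₁ ≤ τ → τ ≤ σ → σ ≤ T₄ → ∫ r in τ..σ, N r ≤ K := fun h₁ h₂ h₃ =>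
    intervalIntegral.integral_mono_interval h₁ h₂ h₃
      ((ae_restrict_iff' measurableSet_Ioc).2 <| .of_forall fun r hr => hN0 r ⟨hr.1.le, hr.2⟩) hNint
  have hK0 : 0 ≤ K := intervalIntegral.integral_nonneg (ht₁.trans htT.le) hN0
  have hgrowth : ∀ τ ∈ Set.Icc t T₄, F t ≤ a * N τ + c * K := fun τ hτ => by
    have hss : Set.Icc t τ ⊆ Set.Icc T₁ T₄ := Set.Icc_subset_Icc ht₁ hτ.2
    have key := intervalIntegral.sub_le_integral_of_hasDeriv_right_of_le (g := fun r => -F r)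
      (g' := fun r => -F' r) (φ := fun r => c * N r) hτ.1
      (fun r hr => ((hF r (hss hr)).continuousWithinAt.mono hss).neg)
      (fun r hr => ((hF r (hss (Set.Ioo_subset_Icc_self hr))).hasDerivAt (Icc_mem_nhds
        (ht₁.trans_lt hr.1) (hr.2.trans_le hτ.2))).hasDerivWithinAt.neg)
      ((continuousOn_const.mul (hN.mono hss)).integrableOn_Icc)
      (fun r hr => neg_le.1 (hF' r (hss (Set.Ioo_subset_Icc_self hr))))
    rw [intervalIntegral.integral_const_mul] at key
    have := mul_le_mul_of_nonneg_left (hsub ht₁ hτ.1 hτ.2) hc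
    linarith [hFN τ ⟨ht₁.trans hτ.1, hτ.2⟩]
  have hNt : IntervalIntegrable N volume t T₄ :=
    (hN.mono (Set.Icc_subset_Icc_left ht₁)).intervalIntegrable_of_Icc htT.le
  have hav : (T₄ - t) * F t ≤ a * K + (T₄ - t) * (c * K) := by
    have h := intervalIntegral.integral_mono_on htT.le intervalIntegrable_const
      ((hNt.const_mul a).add intervalIntegrable_const) hgrowth
    rw [intervalIntegral.integral_add (hNt.const_mul a) intervalIntegrable_const,
      intervalIntegral.integral_const_mul] at h
    simp only [intervalIntegral.integral_const, smul_eq_mul] at h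
    linarith [mul_le_mul_of_nonneg_left (hsub ht₁ htT.le le_rfl) ha]
  have hd : 0 < T₄ - t := sub_pos.2 htT
  calc F t ≤ a * K / (T₄ - t) + c * K := by
        rw [← sub_le_iff_le_add, le_div_iff₀ hd]
        linarith
    _ ≤ a * K / (T₄ - T₃) + c * K := by
        have : 0 < T₄ - T₃ := sub_pos.2 hT
        gcongr
    _ = _ := by ring

/-- Maximal inequality for supersolutions on a fixed finite set. -/
theorem maximal_inequality_supersolution {X : Type*} [Countable X]
    (m : X → ℝ) (hm : ∀ x, 0 < m x)
    (b : X → X → ℝ) (hb0 : ∀ x y, 0 ≤ b x y) (hbs : ∀ x y, b x y = b y x)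
    (hbl : ∀ x, b x x = 0) (hlf : ∀ x, {y | b x y ≠ 0}.Finite)
    (hconn : ∀ x y, Relation.ReflTransGen (fun u v => 0 < b u v) x y)
    (B : Finset X) (μ : X → ℝ) (hμ : ∀ x ∈ B, 0 < μ x)
    (p q : ℝ≥0∞) (hp : 1 ≤ p) (hpq : 1 / p + 1 / q = 1)
    (ω : X → ℝ) (hω : Bd ω)
    (T₁ T₂ T₃ T₄ : ℝ) (hT₁₂ : T₁ ≤ T₂) (hT₂₃ : T₂ ≤ T₃) (hT₃₄ : T₃ < T₄)
    (s : ℝ) (hs : 1 ≤ s)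
    (v v' : ℝ → X → ℝ)
    (hvnn : ∀ t ∈ Set.Icc T₁ T₄, ∀ z, 0 ≤ v t z)
    (hvbd : ∃ M, ∀ t ∈ Set.Icc T₁ T₄, ∀ z, v t z ≤ M)
    (hv : ∀ z ∈ B, ∀ t ∈ Set.Icc T₁ T₄,
      HasDerivWithinAt (fun u => v u z) (v' t z) (Set.Icc T₁ T₄) t)
    (hv' : ∀ z ∈ B, ContinuousOn (fun t => v' t z) (Set.Icc T₁ T₄))
    (hsup : ∀ t ∈ Set.Icc T₁ T₄, ∀ z ∈ B, 0 ≤ v' t z + lapOm b m ω (v t) z) :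
    (⨆ t : Set.Icc T₂ T₃, lpF B μ 1 (fun x => v ↑t x ^ s))
      ≤ ((∑ x ∈ B, μ x) ^ (1 / p.toReal) / (T₄ - T₃) + s * lpF B μ p (Deg b m)) *
          ∫ τ in T₁..T₄, lpF B μ q (fun x => v τ x ^ s) := by
  have hconj : p.HolderConjugate q := ⟨by simpa using hpq⟩
  have hq : 1 ≤ q := hconj.symm.one_le
  have : Nonempty (Set.Icc T₂ T₃) := ⟨⟨T₂, le_rfl, hT₂₃⟩⟩
  have habs : ∀ t ∈ Set.Icc T₁ T₄, ∀ x, |v t x ^ s| = v t x ^ s := fun t ht x =>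
    abs_of_nonneg (rpow_nonneg (hvnn t ht x) s)
  have hvs : ∀ x ∈ B, ∀ t ∈ Set.Icc T₁ T₄, HasDerivWithinAt (fun u => v u x ^ s)
      (v' t x * s * v t x ^ (s - 1)) (Set.Icc T₁ T₄) t := fun x hx t ht =>
    (hv x hx t ht).rpow_const (Or.inr hs)
  refine ciSup_le fun ⟨t, ht⟩ => ?_
  have htI : t ∈ Set.Icc T₁ T₄ := ⟨hT₁₂.trans ht.1, ht.2.trans hT₃₄.le⟩
  have hL1 : lpF B μ 1 (fun x => v t x ^ s) = ∑ x ∈ B, μ x * v t x ^ s := by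
    simp only [lpF_one, habs t htI]
  rw [hL1]
  refine le_integral_of_neg_le_deriv (F := fun τ => ∑ x ∈ B, μ x * v τ x ^ s)
    (F' := fun τ => ∑ x ∈ B, μ x * (v' τ x * s * v τ x ^ (s - 1)))
    htI.1 ht.2 hT₃₄ (rpow_nonneg (Finset.sum_nonneg fun x hx => (hμ x hx).le) _)
    (mul_nonneg (zero_le_one.trans hs) (lpF_nonneg hμ))
    (fun τ hτ => HasDerivWithinAt.fun_sum fun x hx => (hvs x hx τ hτ).const_mul _)
    (continuousOn_lpF hq fun x hx τ hτ => (hvs x hx τ hτ).continuousWithinAt)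
    (fun τ _ => lpF_nonneg hμ) (fun τ hτ => ?_) (fun τ hτ => ?_)
  · have hH := sum_mul_le_lpF_mul_lpF (f := Deg b m) (g := fun x => v τ x ^ s) hμ hconj
    simp only [habs τ hτ, abs_of_nonneg (Deg_nonneg hm hb0 _)] at hH
    have hs0 : 0 ≤ s := zero_le_one.trans hs
    refine le_trans (neg_le_neg ((mul_le_mul_of_nonneg_left hH hs0).trans_eq
      (mul_assoc _ _ _).symm)) ?_
    rw [Finset.mul_sum, ← Finset.sum_neg_distrib]
    refine Finset.sum_le_sum fun x hx => ?_
    have hx0 := hvnn τ hτ x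
    have hd : 0 ≤ v' τ x + Deg b m x * v τ x :=
      (hsup τ hτ x hx).trans
        (add_le_add_right (lapOm_le_Deg_mul hm hb0 hlf ω (hvnn τ hτ) x) _)
    have hpow : v τ x ^ s = v τ x * v τ x ^ (s - 1) := by
      rw [← rpow_one_add' hx0 (by linarith), add_sub_cancel]
    have := mul_nonneg (mul_nonneg (hμ x hx).le hs0) (mul_nonneg hd (rpow_nonneg hx0 (s - 1)))
    rw [hpow]
    linarith
  · have hH := sum_mul_le_lpF_mul_lpF (f := fun _ => 1) (g := fun x => v τ x ^ s) hμ hconj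
    simp only [habs τ hτ, abs_one, one_mul] at hH
    exact hH.trans (mul_le_mul_of_nonneg_right (lpF_const_one_le B μ p) (lpF_nonneg hμ))

end GraphHeat
end
end
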